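/- arXiv:2302.13767 — 3 statements merged into one kernel-verified Lean document; each statement's English description precedes it below -/
import Mathlib

section
/- For n ≥ 2, the number of Fishburn permutations of length n avoiding both classical patterns 321 and 1243 equals n² − 3n + 4. -/
/-- A permutation `π` of `Fin n` contains the classical pattern `p` (given as a
function `Fin k → ℕ` listing the pattern's entries). -/
def Contains {n k : ℕ} (π : Equiv.Perm (Fin n)) (p : Fin k → ℕ) : Prop :=
  ∃ f : Fin k → Fin n, StrictMono f ∧ ∀ i j, p i < p j ↔ π (f i) < π (f j)

/-- Classical pattern avoidance. -/
def Avoids {n k : ℕ} (π : Equiv.Perm (Fin n)) (p : Fin k → ℕ) : Prop :=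
  ¬ Contains π p

/-- A permutation is Fishburn if there are no indices `i < j` with
`π i, π (i+1), π j` forming a 231 pattern and `π i = π j + 1`. -/
def IsFishburn {n : ℕ} (π : Equiv.Perm (Fin n)) : Prop :=
  ¬ ∃ (i j : ℕ) (hij : i + 1 < j) (hj : j < n),
      π ⟨i, by omega⟩ < π ⟨i + 1, by omega⟩ ∧
      π ⟨j, hj⟩ < π ⟨i, by omega⟩ ∧
      (π ⟨i, by omega⟩ : ℕ) = (π ⟨j, hj⟩ : ℕ) + 1

/-- The one-line notation of a permutation of `Fin n`, extended by the identity to all of `ℕ`. -/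
def wordOf {n : ℕ} (π : Equiv.Perm (Fin n)) (i : ℕ) : ℕ :=
  if h : i < n then π ⟨i, h⟩ else i

theorem wordOf_val {n : ℕ} (π : Equiv.Perm (Fin n)) (i : Fin n) : wordOf π i = π i := by
  simp [wordOf]

theorem wordOf_lt {n : ℕ} (π : Equiv.Perm (Fin n)) {i : ℕ} (h : i < n) : wordOf π i < n := by
  simp [wordOf, h]

theorem wordOf_of_le {n : ℕ} (π : Equiv.Perm (Fin n)) {i : ℕ} (h : n ≤ i) : wordOf π i = i := by
  simp [wordOf, h]

theorem wordOf_left_injective {n : ℕ} : Function.Injective (wordOf (n := n)) := by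
  intro π σ h
  ext i
  rw [← wordOf_val, ← wordOf_val, h]

theorem wordOf_injective {n : ℕ} (π : Equiv.Perm (Fin n)) : Function.Injective (wordOf π) := by
  intro i j h
  rcases lt_or_ge i n with hi | hi <;> rcases lt_or_ge j n with hj | hj
  · simp only [wordOf, hi, hj, dif_pos] at h
    simpa using π.injective (Fin.ext h)
  · have := wordOf_lt π hi
    rw [h, wordOf_of_le π hj] at this
    omega
  · have := wordOf_lt π hj
    rw [← h, wordOf_of_le π hi] at this
    omega
  · rwa [wordOf_of_le π hi, wordOf_of_le π hj] at h

theorem wordOf_surjective {n : ℕ} (π : Equiv.Perm (Fin n)) : Function.Surjective (wordOf π) := by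
  intro y
  rcases lt_or_ge y n with hy | hy
  · exact ⟨π.symm ⟨y, hy⟩, by simp [wordOf_val]⟩
  · exact ⟨y, wordOf_of_le π hy⟩

theorem exists_wordOf_eq {n : ℕ} {w : ℕ → ℕ} (hinj : Function.Injective w)
    (hlt : ∀ i < n, w i < n) (hfix : ∀ i, n ≤ i → w i = i) :
    ∃ π : Equiv.Perm (Fin n), wordOf π = w := by
  have hf : Function.Injective fun i : Fin n => (⟨w i, hlt i i.2⟩ : Fin n) := by
    intro i j h
    exact Fin.ext (hinj (Fin.mk.inj_iff.1 h))
  refine ⟨Equiv.ofBijective _ (Finite.injective_iff_bijective.1 hf), funext fun i => ?_⟩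
  rcases lt_or_ge i n with hi | hi
  · simp [wordOf, hi]
  · simp [wordOf, hi, hfix]

theorem contains_321_iff {n : ℕ} (π : Equiv.Perm (Fin n)) :
    Contains π ![3, 2, 1] ↔ ∃ a b c : Fin n, a < b ∧ b < c ∧ π c < π b ∧ π b < π a := by
  constructor
  · rintro ⟨f, hf, h⟩
    exact ⟨f 0, f 1, f 2, hf (by decide), hf (by decide), (h 2 1).1 (by decide),
      (h 1 0).1 (by decide)⟩
  · rintro ⟨a, b, c, hab, hbc, h1, h2⟩
    refine ⟨![a, b, c], ?_, ?_⟩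
    · intro i j
      fin_cases i <;> fin_cases j <;> simp <;> order
    · intro i j
      fin_cases i <;> fin_cases j <;> simp <;> order

theorem contains_1243_iff {n : ℕ} (π : Equiv.Perm (Fin n)) :
    Contains π ![1, 2, 4, 3] ↔
      ∃ a b c d : Fin n, a < b ∧ b < c ∧ c < d ∧ π a < π b ∧ π b < π d ∧ π d < π c := by
  constructor
  · rintro ⟨f, hf, h⟩
    exact ⟨f 0, f 1, f 2, f 3, hf (by decide), hf (by decide), hf (by decide),
      (h 0 1).1 (by decide), (h 1 3).1 (by decide), (h 3 2).1 (by decide)⟩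
  · rintro ⟨a, b, c, d, hab, hbc, hcd, h1, h2, h3⟩
    refine ⟨![a, b, c, d], ?_, ?_⟩
    · intro i j
      fin_cases i <;> fin_cases j <;> simp <;> order
    · intro i j
      fin_cases i <;> fin_cases j <;> simp <;> order

/-- The Fishburn condition together with avoidance of `321` and `1243`, for words on `ℕ`. -/
structure IsAvoidingFishburnWord (w : ℕ → ℕ) : Prop where
  fishburn : ∀ i j, i + 1 < j → w i < w (i + 1) → w i ≠ w j + 1
  avoids_321 : ∀ a b c, a < b → b < c → w c < w b → ¬ w b < w a
  avoids_1243 : ∀ a b c d, a < b → b < c → c < d → w a < w b → w b < w d → ¬ w d < w c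

theorem lt_of_wordOf_lt {n : ℕ} (π : Equiv.Perm (Fin n)) {i j : ℕ} (hij : i < j)
    (h : wordOf π j < wordOf π i) : j < n := by
  by_contra! hj
  rw [wordOf_of_le π hj] at h
  rcases lt_or_ge i n with hi | hi
  · have := wordOf_lt π hi
    omega
  · rw [wordOf_of_le π hi] at h
    omega

theorem isAvoidingFishburnWord_wordOf_iff {n : ℕ} (π : Equiv.Perm (Fin n)) :
    IsAvoidingFishburnWord (wordOf π) ↔
      IsFishburn π ∧ Avoids π ![3, 2, 1] ∧ Avoids π ![1, 2, 4, 3] := by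
  have key : ∀ i (hi : i < n), wordOf π i = π ⟨i, hi⟩ := fun i hi => by simp [wordOf, hi]
  constructor
  · rintro ⟨h1, h2, h3⟩
    refine ⟨?_, ?_, ?_⟩
    · rintro ⟨i, j, hij, hj, h, -, h'⟩
      refine h1 i j hij ?_ ?_
      · rw [key i (by omega), key (i + 1) (by omega)]
        exact h
      · rw [key i (by omega), key j hj]
        exact h'
    · rw [Avoids, contains_321_iff]
      rintro ⟨a, b, c, hab, hbc, h, h'⟩
      exact h2 a b c hab hbc (by simpa [wordOf_val] using h) (by simpa [wordOf_val] using h')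
    · rw [Avoids, contains_1243_iff]
      rintro ⟨a, b, c, d, hab, hbc, hcd, h, h', h''⟩
      exact h3 a b c d hab hbc hcd (by simpa [wordOf_val] using h)
        (by simpa [wordOf_val] using h') (by simpa [wordOf_val] using h'')
  · rintro ⟨h1, h2, h3⟩
    rw [Avoids, contains_321_iff] at h2
    rw [Avoids, contains_1243_iff] at h3
    refine ⟨?_, ?_, ?_⟩
    · intro i j hij h h'
      have hj : j < n := lt_of_wordOf_lt π (i := i) (by omega) (by omega)
      rw [key i (by omega), key (i + 1) (by omega)] at h
      rw [key i (by omega), key j hj] at h'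
      exact h1 ⟨i, j, hij, hj, h, Fin.lt_def.2 (by omega), h'⟩
    · intro a b c hab hbc h h'
      have hc : c < n := lt_of_wordOf_lt π hbc h
      rw [key c hc, key b (by omega)] at h
      rw [key b (by omega), key a (by omega)] at h'
      exact h2 ⟨_, _, _, hab, hbc, h, h'⟩
    · intro a b c d hab hbc hcd h h' h''
      have hd : d < n := lt_of_wordOf_lt π hcd h''
      rw [key a (by omega), key b (by omega)] at h
      rw [key b (by omega), key d hd] at h'
      rw [key d hd, key c (by omega)] at h''
      exact h3 ⟨_, _, _, _, hab, hbc, hcd, h, h', h''⟩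

/-- The word `0, m, …` whose remaining entries increase. -/
def zeroWord (m i : ℕ) : ℕ :=
  if i = 0 then 0 else if i = 1 then m else if i ≤ m then i - 1 else i

/-- The word `k, 0, m, …` (for `k < m`) whose remaining entries increase. -/
def jumpWord (k m i : ℕ) : ℕ :=
  if i = 0 then k else if i = 1 then 0 else if i = 2 then m
  else if i < k + 2 then i - 2 else if i ≤ m then i - 1 else i

/-- The word `k, 0, k + 1, …, k + j, …` whose remaining entries increase. -/
def runWord (k j i : ℕ) : ℕ :=
  if i = 0 then k else if i = 1 then 0 else if i ≤ j + 1 then k + i - 1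
  else if i ≤ j + k then i - j - 1 else i

theorem zeroWord_isAvoidingFishburnWord {m : ℕ} (hm : 1 ≤ m) :
    IsAvoidingFishburnWord (zeroWord m) := by
  refine ⟨?_, ?_, ?_⟩
  · intro i j hij
    unfold zeroWord
    split_ifs <;> omega
  · intro a b c hab hbc
    unfold zeroWord
    split_ifs <;> omega
  · intro a b c d hab hbc hcd _ _
    unfold zeroWord
    split_ifs <;> omega

theorem jumpWord_descent {k m i j : ℕ} (hij : i < j) (h : jumpWord k m j < jumpWord k m i) :
    i = 0 ∨ i = 2 := by
  unfold jumpWord at h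
  split_ifs at h <;> omega

theorem jumpWord_isAvoidingFishburnWord {k m : ℕ} (hk : 1 ≤ k) (hm : k + 2 ≤ m) :
    IsAvoidingFishburnWord (jumpWord k m) := by
  have h0 : jumpWord k m 0 = k := rfl
  have h1 : jumpWord k m 1 = 0 := rfl
  have h2 : jumpWord k m 2 = m := rfl
  have h3 : jumpWord k m 3 < m := by
    unfold jumpWord
    split_ifs <;> omega
  refine ⟨?_, ?_, ?_⟩
  · intro i j hij h h'
    obtain rfl | rfl := jumpWord_descent (k := k) (m := m) (show i < j by omega) (by omega)
    · rw [Nat.zero_add] at h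
      omega
    · rw [show 2 + 1 = 3 from rfl] at h
      omega
  · intro a b c hab hbc h h'
    obtain rfl : b = 2 := by
      have := jumpWord_descent hbc h
      omega
    interval_cases a <;> omega
  · intro a b c d hab hbc hcd h _ hdc
    have := jumpWord_descent hcd hdc
    obtain rfl : b = 1 := by omega
    omega

theorem runWord_isAvoidingFishburnWord {k j : ℕ} (hk : 1 ≤ k) :
    IsAvoidingFishburnWord (runWord k j) := by
  refine ⟨?_, ?_, ?_⟩
  · intro i j hij
    unfold runWord
    split_ifs <;> omega
  · intro a b c hab hbc
    unfold runWord
    split_ifs <;> omega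
  · intro a b c d hab hbc hcd _ hbd hdc
    have hd : runWord k j d < k := by
      unfold runWord at hdc ⊢
      split_ifs at hdc ⊢ <;> omega
    have hc : c ≤ j + 1 := by
      unfold runWord at hdc
      split_ifs at hdc <;> omega
    have hb : b = 1 ∨ k < runWord k j b := by
      unfold runWord
      split_ifs <;> omega
    obtain rfl | hb := hb
    · simp_all [runWord]
    · omega

theorem zeroWord_injective {m : ℕ} (hm : 1 ≤ m) : Function.Injective (zeroWord m) := by
  intro a b
  unfold zeroWord
  split_ifs <;> omega

theorem jumpWord_injective {k m : ℕ} (hk : 1 ≤ k) (hm : k + 2 ≤ m) :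
    Function.Injective (jumpWord k m) := by
  intro a b
  unfold jumpWord
  split_ifs <;> omega

theorem runWord_injective {k j : ℕ} (hk : 1 ≤ k) : Function.Injective (runWord k j) := by
  intro a b
  unfold runWord
  split_ifs <;> omega

theorem runWord_eq_one_iff {k j i : ℕ} (hk : 2 ≤ k) : runWord k j i = 1 ↔ i = j + 2 := by
  constructor
  · intro h
    unfold runWord at h
    split_ifs at h
    all_goals omega
  · rintro rfl
    rw [runWord, if_neg (by omega), if_neg (by omega), if_neg (by omega), if_pos (by omega)]
    omega

/-- A single parametrization of the three families of words. -/
def codeWord : ℕ ⊕ ℕ × ℕ → ℕ → ℕ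
  | .inl m => if m = 0 then runWord 1 0 else zeroWord m
  | .inr (a, b) => if a < b then jumpWord (a + 1) (b + 2) else runWord (b + 2) (a - b)

theorem codeWord_isAvoidingFishburnWord (c : ℕ ⊕ ℕ × ℕ) :
    IsAvoidingFishburnWord (codeWord c) := by
  rcases c with m | ⟨a, b⟩ <;> simp only [codeWord] <;> split_ifs
  · exact runWord_isAvoidingFishburnWord le_rfl
  · exact zeroWord_isAvoidingFishburnWord (by omega)
  · exact jumpWord_isAvoidingFishburnWord (by omega) (by omega)
  · exact runWord_isAvoidingFishburnWord (by omega)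

theorem codeWord_injective (c : ℕ ⊕ ℕ × ℕ) : Function.Injective (codeWord c) := by
  rcases c with m | ⟨a, b⟩ <;> simp only [codeWord] <;> split_ifs
  · exact runWord_injective le_rfl
  · exact zeroWord_injective (by omega)
  · exact jumpWord_injective (by omega) (by omega)
  · exact runWord_injective (by omega)

theorem codeWord_left_injective : Function.Injective codeWord := by
  intro c d h
  have h0 := congrFun h 0
  have h1 := congrFun h 1
  have h2 := congrFun h 2
  rcases c with m | ⟨a, b⟩ <;> rcases d with m' | ⟨a', b'⟩
  · simp only [codeWord] at h0 h1
    split_ifs at h0 h1 <;> simp_all [runWord, zeroWord]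
  · simp only [codeWord] at h0 h2
    split_ifs at h0 h2 <;> simp [runWord, zeroWord, jumpWord] at h0 h2
    all_goals omega
  · simp only [codeWord] at h0 h2
    split_ifs at h0 h2 <;> simp [runWord, zeroWord, jumpWord] at h0 h2
    all_goals omega
  · have h3 := congrFun h (a - b + 2)
    suffices a = a' ∧ b = b' by simp [this]
    simp only [codeWord] at h0 h2 h3
    clear h h1
    by_cases hab : a < b <;> by_cases hab' : a' < b' <;>
      simp only [hab, hab', if_true, if_false] at h0 h2 h3
    · simp [jumpWord] at h0 h2
      omega
    · simp [runWord, jumpWord] at h0 h2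
      split_ifs at h2
      all_goals omega
    · simp [runWord, jumpWord] at h0 h2
      split_ifs at h2
      all_goals omega
    · obtain rfl : b = b' := by simpa [runWord] using h0
      rw [(runWord_eq_one_iff (by omega)).2 rfl] at h3
      have := (runWord_eq_one_iff (by omega)).1 h3.symm
      omega

/-- The codes of permutations of `Fin n`, as a subset of all codes. -/
def natCode (n : ℕ) : Fin n ⊕ Fin (n - 2) × Fin (n - 2) → ℕ ⊕ ℕ × ℕ :=
  Sum.map Fin.val (Prod.map Fin.val Fin.val)

theorem natCode_injective (n : ℕ) : Function.Injective (natCode n) :=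
  Fin.val_injective.sumMap (Fin.val_injective.prodMap Fin.val_injective)

theorem codeWord_natCode_lt {n : ℕ} (hn : 2 ≤ n) (c : Fin n ⊕ Fin (n - 2) × Fin (n - 2)) :
    ∀ i < n, codeWord (natCode n c) i < n := by
  intro i hi
  rcases c with ⟨m, hm⟩ | ⟨⟨a, ha⟩, ⟨b, hb⟩⟩ <;> simp only [codeWord, natCode, Sum.map, Prod.map,
    Sum.elim_inl, Sum.elim_inr, Function.comp_apply] <;> split_ifs <;>
    simp only [runWord, zeroWord, jumpWord] <;> split_ifs <;> omega

theorem codeWord_natCode_of_le {n : ℕ} (hn : 2 ≤ n) (c : Fin n ⊕ Fin (n - 2) × Fin (n - 2)) :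
    ∀ i, n ≤ i → codeWord (natCode n c) i = i := by
  intro i hi
  rcases c with ⟨m, hm⟩ | ⟨⟨a, ha⟩, ⟨b, hb⟩⟩ <;> simp only [codeWord, natCode, Sum.map, Prod.map,
    Sum.elim_inl, Sum.elim_inr, Function.comp_apply] <;> split_ifs <;>
    simp only [runWord, zeroWord, jumpWord] <;> split_ifs <;> omega

theorem codeWord_surjective (c : ℕ ⊕ ℕ × ℕ) : Function.Surjective (codeWord c) := by
  obtain ⟨n, hn, c, rfl⟩ : ∃ n, 2 ≤ n ∧ ∃ c', natCode n c' = c := by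
    rcases c with m | ⟨a, b⟩
    · exact ⟨m + 2, by omega, .inl ⟨m, by omega⟩, rfl⟩
    · exact ⟨a + b + 3, by omega, .inr (⟨a, by omega⟩, ⟨b, by omega⟩), rfl⟩
  obtain ⟨π, hπ⟩ := exists_wordOf_eq (codeWord_injective _) (codeWord_natCode_lt hn c)
    (codeWord_natCode_of_le hn c)
  exact hπ ▸ wordOf_surjective π

theorem codeWord_bijective (c : ℕ ⊕ ℕ × ℕ) : Function.Bijective (codeWord c) :=
  ⟨codeWord_injective c, codeWord_surjective c⟩

theorem codeWord_inl_zero : codeWord (.inl 0) = runWord 1 0 := rfl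

theorem codeWord_inl {m : ℕ} (hm : 1 ≤ m) : codeWord (.inl m) = zeroWord m :=
  if_neg (by omega)

theorem codeWord_inr_jump {k m : ℕ} (hk : 1 ≤ k) (hm : k + 2 ≤ m) :
    codeWord (.inr (k - 1, m - 2)) = jumpWord k m := by
  rw [codeWord, if_pos (by omega), Nat.sub_add_cancel hk, Nat.sub_add_cancel (by omega)]

theorem codeWord_inr_run {k j : ℕ} (hk : 2 ≤ k) :
    codeWord (.inr (k - 2 + j, k - 2)) = runWord k j := by
  rw [codeWord, if_neg (by omega), Nat.sub_add_cancel hk, Nat.add_sub_cancel_left]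

theorem exists_natCode_eq {n : ℕ} (hn : 2 ≤ n) {c : ℕ ⊕ ℕ × ℕ}
    (hlt : ∀ i < n, codeWord c i < n) (hfix : ∀ i, n ≤ i → codeWord c i = i) :
    ∃ c', natCode n c' = c := by
  rcases c with m | ⟨a, b⟩
  · suffices hm : m < n from ⟨.inl ⟨m, hm⟩, rfl⟩
    rcases Nat.eq_zero_or_pos m with rfl | hm
    · omega
    · have := hlt 1 (by omega)
      rwa [codeWord_inl hm] at this
  · suffices hab : a < n - 2 ∧ b < n - 2 from ⟨.inr (⟨a, hab.1⟩, ⟨b, hab.2⟩), rfl⟩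
    by_cases hab : a < b
    · have h2 : codeWord (.inr (a, b)) 2 = b + 2 := by simp [codeWord, hab, jumpWord]
      rcases lt_or_ge 2 n with hn2 | hn2
      · have := hlt 2 hn2
        omega
      · have := hfix 2 hn2
        omega
    · have h0 : codeWord (.inr (a, b)) 0 = b + 2 := by simp [codeWord, hab, runWord]
      have hb := hlt 0 (by omega)
      rcases Nat.eq_zero_or_pos (a - b) with hz | hpos
      · omega
      · have h1 : codeWord (.inr (a, b)) (a - b + 1) = a + 2 := by
          rw [codeWord, if_neg hab, runWord, if_neg (by omega), if_neg (by omega),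
            if_pos le_rfl]
          omega
        rcases lt_or_ge (a - b + 1) n with hn1 | hn1
        · have := hlt _ hn1
          omega
        · have := hfix _ hn1
          omega

/-- A word is determined by a prefix if it increases afterwards. -/
theorem eq_of_eq_prefix {v w : ℕ → ℕ} (hv : Function.Bijective v) (hw : Function.Bijective w)
    {p : ℕ} (hpre : ∀ i < p, v i = w i) (hvp : StrictMonoOn v (Set.Ici p))
    (hwp : StrictMonoOn w (Set.Ici p)) : v = w := by
  have aux : ∀ {v w : ℕ → ℕ}, Function.Injective v → Function.Surjective w →
      StrictMonoOn w (Set.Ici p) → ∀ i, p ≤ i → (∀ j < i, v j = w j) → w i ≤ v i := by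
    intro v w hv hw hwp i hi ih
    by_contra! h
    obtain ⟨j, hj⟩ := hw (v i)
    rcases lt_trichotomy j i with hji | rfl | hji
    · have := hv ((ih j hji).trans hj)
      omega
    · omega
    · have := hwp (Set.mem_Ici.2 hi) (Set.mem_Ici.2 (by omega)) hji
      omega
  funext i
  induction i using Nat.strong_induction_on with
  | _ i ih =>
    rcases lt_or_ge i p with hi | hi
    · exact hpre i hi
    · exact le_antisymm (aux hw.1 hv.2 hvp i hi fun j hj => (ih j hj).symm)
        (aux hv.1 hw.2 hwp i hi ih)

namespace IsAvoidingFishburnWord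

variable {w : ℕ → ℕ}

theorem strictMonoOn_Ici (h : IsAvoidingFishburnWord w) (hw : Function.Injective w) {p q : ℕ}
    (hqp : q < p) (hq : w q = 0) (hp : (∃ r < p, w p < w r) ∨ ∀ i, p < i → w p < w i) :
    StrictMonoOn w (Set.Ici p) := by
  intro i hi j _ hij
  rw [Set.mem_Ici] at hi
  by_contra! hle
  have hne : w i ≠ w j := fun e => by have := hw e; omega
  have hpj : w p < w j := by
    rcases hp with ⟨r, hr, hpr⟩ | hp
    · by_contra! hjp
      have hne' : w p ≠ w j := fun e => by have := hw e; omega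
      exact h.avoids_321 r p j hr (by omega) (by omega) hpr
    · exact hp j (by omega)
  have hip : p < i := lt_of_le_of_ne hi fun e => by subst e; omega
  have hqw : w q ≠ w p := fun e => by have := hw e; omega
  exact h.avoids_1243 q p i j hqp hip hij (by omega) hpj (by omega)

/-- If the value just below `w i` does not occur before `i`, then `i` is a descent. -/
theorem succ_lt (h : IsAvoidingFishburnWord w) (hw : Function.Bijective w) {i : ℕ}
    (hpos : 0 < w i) (hpre : ∀ j < i, w j + 1 ≠ w i) : w (i + 1) < w i := by
  obtain ⟨j, hj⟩ := hw.2 (w i - 1)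
  have hji : ¬ j < i := fun hlt => hpre j hlt (by omega)
  have hne : j ≠ i := fun e => by subst e; omega
  rcases Nat.lt_or_ge (i + 1) j with hlt | hge
  · by_contra! hle
    have hne' : w i ≠ w (i + 1) := fun e => by have := hw.1 e; omega
    exact h.fishburn i j hlt (by omega) (by omega)
  · obtain rfl : j = i + 1 := by omega
    omega

theorem eq_zeroWord (h : IsAvoidingFishburnWord w) (hw : Function.Bijective w) (h0 : w 0 = 0)
    (hz : Function.Bijective (zeroWord (w 1))) : w = zeroWord (w 1) := by
  have h1 : w 1 ≠ 0 := fun e => by simpa using hw.1 (e.trans h0.symm)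
  have mono : StrictMonoOn w (Set.Ici 2) := by
    by_cases h1' : w 1 = 1
    · have : StrictMonoOn w (Set.Ici 1) := by
        refine h.strictMonoOn_Ici hw.1 Nat.zero_lt_one h0 (Or.inr fun i hi => ?_)
        have := hw.1.ne (show i ≠ 0 by omega)
        have := hw.1.ne (show i ≠ 1 by omega)
        omega
      exact this.mono (Set.Ici_subset_Ici.2 (by omega))
    · have h2 : w 2 < w 1 := h.succ_lt hw (by omega) fun j hj => by
        obtain rfl : j = 0 := by omega
        omega
      exact h.strictMonoOn_Ici hw.1 (by omega) h0 (Or.inl ⟨1, by omega, h2⟩)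
  refine eq_of_eq_prefix hw hz (p := 2) (fun i hi => ?_) mono ?_
  · interval_cases i <;> simp [zeroWord, h0]
  · intro i hi j hj hij
    rw [Set.mem_Ici] at hi hj
    unfold zeroWord
    split_ifs <;> omega

theorem apply_one_eq_zero (h : IsAvoidingFishburnWord w) (hw : Function.Bijective w)
    (h0 : w 0 ≠ 0) : w 1 = 0 := by
  have h1 : w 1 < w 0 := h.succ_lt hw (by omega) (by omega)
  obtain ⟨j, hj⟩ := hw.2 0
  by_contra h1'
  have hj0 : j ≠ 0 := by rintro rfl; omega
  have hj1 : j ≠ 1 := by rintro rfl; omega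
  exact h.avoids_321 0 1 j (by omega) (by omega) (by omega) h1

theorem eq_jumpWord (h : IsAvoidingFishburnWord w) (hw : Function.Bijective w) (h0 : w 0 ≠ 0)
    (h2 : w 0 + 2 ≤ w 2) (hz : Function.Bijective (jumpWord (w 0) (w 2))) :
    w = jumpWord (w 0) (w 2) := by
  have h1 := h.apply_one_eq_zero hw h0
  have h3 : w 3 < w 2 := h.succ_lt hw (by omega) fun j hj => by
    interval_cases j <;> omega
  refine eq_of_eq_prefix hw hz (p := 3) (fun i hi => ?_)
    (h.strictMonoOn_Ici hw.1 (q := 1) (by omega) h1 (Or.inl ⟨2, by omega, h3⟩)) ?_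
  · interval_cases i <;> simp [jumpWord, h1]
  · intro i hi j hj hij
    rw [Set.mem_Ici] at hi hj
    unfold jumpWord
    split_ifs <;> omega

theorem eq_runWord_one (h : IsAvoidingFishburnWord w) (hw : Function.Bijective w) (h0 : w 0 = 1)
    (h2 : w 2 < w 0 + 2) (hz : Function.Bijective (runWord 1 0)) : w = runWord 1 0 := by
  have h1 := h.apply_one_eq_zero hw (by omega)
  have hbig : ∀ i, 2 ≤ i → 2 ≤ w i := fun i hi => by
    have := hw.1.ne (show i ≠ 0 by omega)
    have := hw.1.ne (show i ≠ 1 by omega)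
    omega
  refine eq_of_eq_prefix hw hz (p := 2) (fun i hi => ?_)
    (h.strictMonoOn_Ici hw.1 (q := 1) (by omega) h1 (Or.inr fun i hi => ?_)) ?_
  · interval_cases i <;> simp [runWord, h0, h1]
  · have := hbig i (by omega)
    have := hw.1.ne (show i ≠ 2 by omega)
    omega
  · intro i hi j hj hij
    rw [Set.mem_Ici] at hi hj
    unfold runWord
    split_ifs <;> omega

theorem exists_eq_runWord (h : IsAvoidingFishburnWord w) (hw : Function.Bijective w)
    (h0 : 2 ≤ w 0) (h2 : w 2 < w 0 + 2) (hz : ∀ j, Function.Bijective (runWord (w 0) j)) :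
    ∃ j, w = runWord (w 0) j := by
  have h1 := h.apply_one_eq_zero hw (by omega)
  have hex : ∃ j, w (j + 2) ≠ w 0 + j + 1 := by
    obtain ⟨i, hi⟩ := hw.2 1
    have hi0 : i ≠ 0 := by rintro rfl; omega
    have hi1 : i ≠ 1 := by rintro rfl; omega
    refine ⟨i - 2, ?_⟩
    rw [show i - 2 + 2 = i by omega]
    omega
  obtain ⟨j, hj, hmin⟩ : ∃ j, w (j + 2) ≠ w 0 + j + 1 ∧ ∀ i < j, w (i + 2) = w 0 + i + 1 :=
    ⟨Nat.find hex, Nat.find_spec hex, fun i hi => not_not.1 (Nat.find_min hex hi)⟩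
  have hlt : w (j + 2) < w 0 := by
    by_contra! hge
    have hne0 := hw.1.ne (show j + 2 ≠ 0 by omega)
    rcases Nat.eq_zero_or_pos j with rfl | hjpos
    · simp only [Nat.zero_add] at *
      omega
    · have hgt : w 0 + j + 1 < w (j + 2) := by
        by_contra! hle
        have := hmin (w (j + 2) - w 0 - 1) (by omega)
        have := hw.1 (this.trans (show _ = w (j + 2) by omega))
        omega
      obtain ⟨d, hd⟩ := hw.2 (w 0 + j + 1)
      have hw2 := hmin 0 hjpos
      have hd0 : d ≠ 0 := by rintro rfl; omega
      have hd1 : d ≠ 1 := by rintro rfl; omega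
      have hd2 : j + 2 < d := by
        by_contra! hle
        rcases hle.eq_or_lt with rfl | hlt
        · omega
        · have := hmin (d - 2) (by omega)
          rw [show d - 2 + 2 = d by omega] at this
          omega
      rw [Nat.zero_add] at hw2
      exact h.avoids_1243 1 2 (j + 2) d (by omega) (by omega) hd2 (by omega) (by omega)
        (by omega)
  refine ⟨j, eq_of_eq_prefix hw (hz j) (p := j + 2) (fun i hi => ?_)
    (h.strictMonoOn_Ici hw.1 (q := 1) (by omega) h1 (Or.inl ⟨0, by omega, hlt⟩)) ?_⟩
  · rcases Nat.lt_or_ge i 2 with hi2 | hi2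
    · interval_cases i <;> simp [runWord, h1]
    · have := hmin (i - 2) (by omega)
      rw [show i - 2 + 2 = i by omega] at this
      unfold runWord
      split_ifs <;> omega
  · intro a ha b hb hab
    rw [Set.mem_Ici] at ha hb
    unfold runWord
    split_ifs <;> omega

end IsAvoidingFishburnWord

theorem IsAvoidingFishburnWord.exists_codeWord_eq {w : ℕ → ℕ} (h : IsAvoidingFishburnWord w)
    (hw : Function.Bijective w) : ∃ c, codeWord c = w := by
  by_cases h0 : w 0 = 0
  · have h1 : 1 ≤ w 1 := by
      have := hw.1.ne one_ne_zero
      omega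
    have e := codeWord_inl h1
    exact ⟨_, e.trans (h.eq_zeroWord hw h0 (e ▸ codeWord_bijective _)).symm⟩
  by_cases h2 : w 0 + 2 ≤ w 2
  · have e := codeWord_inr_jump (by omega) h2
    exact ⟨_, e.trans (h.eq_jumpWord hw h0 h2 (e ▸ codeWord_bijective _)).symm⟩
  by_cases h1 : w 0 = 1
  · have e := codeWord_inl_zero
    exact ⟨_, e.trans (h.eq_runWord_one hw h1 (by omega) (e ▸ codeWord_bijective _)).symm⟩
  · have e (j : ℕ) := codeWord_inr_run (k := w 0) (j := j) (by omega)
    obtain ⟨j, hj⟩ := h.exists_eq_runWord hw (by omega) (by omega)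
      fun j => e j ▸ codeWord_bijective _
    exact ⟨_, (e j).trans hj.symm⟩

theorem fishburn_321_1243 (n : ℕ) (hn : 2 ≤ n) :
    ({π : Equiv.Perm (Fin n) | IsFishburn π ∧ Avoids π ![3, 2, 1] ∧ Avoids π ![1, 2, 4, 3]}.ncard : ℤ) = n ^ 2 - 3 * n + 4 := by
  choose perm hperm using fun c => exists_wordOf_eq (codeWord_injective (natCode n c))
    (codeWord_natCode_lt hn c) (codeWord_natCode_of_le hn c)
  have hinj : Function.Injective perm := fun c d hcd =>
    natCode_injective n (codeWord_left_injective (by rw [← hperm, ← hperm, hcd]))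
  have hrange : {π : Equiv.Perm (Fin n) | IsFishburn π ∧ Avoids π ![3, 2, 1] ∧
      Avoids π ![1, 2, 4, 3]} = Set.range perm := by
    ext π
    rw [Set.mem_ofPred_eq, ← isAvoidingFishburnWord_wordOf_iff, Set.mem_range]
    constructor
    · intro h
      obtain ⟨c, hc⟩ := h.exists_codeWord_eq ⟨wordOf_injective π, wordOf_surjective π⟩
      obtain ⟨c, rfl⟩ := exists_natCode_eq hn (c := c) (fun i hi => hc ▸ wordOf_lt π hi)
        (fun i hi => hc ▸ wordOf_of_le π hi)
      exact ⟨c, wordOf_left_injective ((hperm c).trans hc)⟩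
    · rintro ⟨c, rfl⟩
      exact hperm c ▸ codeWord_isAvoidingFishburnWord _
  rw [hrange, ← Set.image_univ, Set.ncard_image_of_injective _ hinj, Set.ncard_univ,
    Nat.card_eq_fintype_card, Fintype.card_sum, Fintype.card_prod, Fintype.card_fin,
    Fintype.card_fin]
  push_cast [hn]
  ring
end

section
/- For n ≥ 3, the number of Fishburn permutations of length n avoiding both classical patterns 321 and 1324 equals (3/2)n² − (13/2)n + 10. -/
section Reformulation

variable {n : ℕ} (π : Equiv.Perm (Fin n))

theorem exists_val_eq {v : ℕ} (hv : v < n) : ∃ x, (π x : ℕ) = v :=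
  ⟨π.symm ⟨v, hv⟩, by simp⟩

theorem apply_val_eq_iff (x y : Fin n) : (π x : ℕ) = π y ↔ (x : ℕ) = y := by
  simp [← Fin.ext_iff]

theorem avoids_321_iff :
    Avoids π ![3, 2, 1] ↔
      ∀ x y z : Fin n, (x : ℕ) < y → (y : ℕ) < z → (π y : ℕ) < π x →
        (π y : ℕ) ≤ π z := by
  constructor
  · intro h x y z hxy hyz h1
    by_contra! h2
    refine h ⟨![x, y, z], ?_, ?_⟩
    · intro i j hij
      fin_cases i <;> fin_cases j <;> simp at hij ⊢ <;> omega
    · intro i j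
      fin_cases i <;> fin_cases j <;> simp <;> omega
  · rintro h ⟨f, hf, hp⟩
    refine (h (f 0) (f 1) (f 2) (hf (by decide)) (hf (by decide)) ?_).not_gt ?_
    · exact (hp 1 0).1 (by simp)
    · exact (hp 2 1).1 (by simp)

theorem avoids_1324_iff :
    Avoids π ![1, 3, 2, 4] ↔
      ∀ w x y z : Fin n, (w : ℕ) < x → (x : ℕ) < y → (y : ℕ) < z →
        (π w : ℕ) < π y → (π y : ℕ) < π x → (π z : ℕ) ≤ π x := by
  constructor
  · intro h w x y z hwx hxy hyz h1 h2
    by_contra! h3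
    refine h ⟨![w, x, y, z], ?_, ?_⟩
    · intro i j hij
      fin_cases i <;> fin_cases j <;> simp at hij ⊢ <;> omega
    · intro i j
      fin_cases i <;> fin_cases j <;> simp <;> omega
  · rintro h ⟨f, hf, hp⟩
    refine (h (f 0) (f 1) (f 2) (f 3) (hf (by decide)) (hf (by decide)) (hf (by decide))
      ?_ ?_).not_gt ?_
    · exact (hp 0 2).1 (by simp)
    · exact (hp 2 1).1 (by simp)
    · exact (hp 1 3).1 (by simp)

theorem isFishburn_iff :
    IsFishburn π ↔
      ∀ x y z : Fin n, (y : ℕ) = x + 1 → (y : ℕ) < z → (π x : ℕ) < π y →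
        (π x : ℕ) ≠ π z + 1 := by
  constructor
  · rintro h ⟨i, hi⟩ ⟨j, hj⟩ ⟨l, hl⟩ hij hjl h1 h2
    simp only at hij hjl
    subst hij
    exact h ⟨i, l, hjl, hl, h1, by rw [Fin.lt_def]; omega, h2⟩
  · rintro h ⟨i, j, hij, hj, h1, -, h3⟩
    exact h ⟨i, by omega⟩ ⟨i + 1, by omega⟩ ⟨j, hj⟩ rfl hij h1 h3

end Reformulation

/-- Two permutations that send corresponding colour classes to the same values, and increase on
each colour class, are equal. -/
theorem perm_eq_of_strictMono_on_colors {n : ℕ} {α : Type*} (c : Fin n → α)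
    {π σ : Equiv.Perm (Fin n)} (hc : ∀ x y, π x = σ y → c x = c y)
    (hπ : ∀ x y, x < y → c x = c y → π x < π y) (hσ : ∀ x y, x < y → c x = c y → σ x < σ y) :
    π = σ := by
  ext1 x
  induction x using WellFoundedLT.induction with
  | ind x ih =>
    rcases lt_trichotomy (π x) (σ x) with h | h | h
    · obtain ⟨y, hy⟩ := σ.surjective (π x)
      have hcy := hc x y hy.symm
      rcases lt_trichotomy x y with hxy | rfl | hxy
      · exact absurd (hσ x y hxy hcy) (by rw [hy]; exact h.asymm)
      · exact hy.symm
      · have := ih y hxy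
        rw [hy] at this
        exact absurd (π.injective this) hxy.ne
    · exact h
    · obtain ⟨y, hy⟩ := π.surjective (σ x)
      have hcy := hc y x hy
      rcases lt_trichotomy x y with hxy | rfl | hxy
      · exact absurd (hπ x y hxy hcy.symm) (by rw [hy]; exact h.asymm)
      · exact hy
      · have := ih y hxy
        rw [hy] at this
        exact absurd (σ.injective this.symm) hxy.ne

theorem exists_perm_of_injOn {n : ℕ} (g : ℕ → ℕ) (hg : ∀ x < n, g x < n)
    (hinj : ∀ x < n, ∀ y < n, x < y → g x ≠ g y) :
    ∃ π : Equiv.Perm (Fin n), ∀ x, (π x : ℕ) = g x := by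
  have h : Function.Injective (fun x : Fin n => (⟨g x, hg x x.2⟩ : Fin n)) := by
    intro x y hxy
    simp only [Fin.mk.injEq] at hxy
    rcases lt_trichotomy (x : ℕ) y with h | h | h
    · exact absurd hxy (hinj x x.2 y y.2 h)
    · exact Fin.ext h
    · exact absurd hxy.symm (hinj y y.2 x x.2 h)
  exact ⟨Equiv.ofBijective _ (Finite.injective_iff_bijective.1 h), fun x => rfl⟩

/-- A one-to-one correspondence between a finset of parameters and the objects it parametrizes
preserves cardinality. -/
theorem ncard_setOf_exists_rel {α β : Type*} (P : Finset α) (R : α → β → Prop)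
    (hex : ∀ p ∈ P, ∃ b, R p b) (huniq : ∀ p ∈ P, ∀ b c, R p b → R p c → b = c)
    (hinj : ∀ p ∈ P, ∀ q ∈ P, ∀ b, R p b → R q b → p = q) :
    {b | ∃ p ∈ P, R p b}.ncard = P.card := by
  rcases P.eq_empty_or_nonempty with rfl | ⟨p₀, hp₀⟩
  · simp
  have : Nonempty β := (hex p₀ hp₀).nonempty
  choose! f hf using hex
  have h : {b | ∃ p ∈ P, R p b} = f '' (P : Set α) := by
    ext b
    constructor
    · rintro ⟨p, hp, hb⟩
      exact ⟨p, hp, huniq p hp _ _ (hf p hp) hb⟩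
    · rintro ⟨p, hp, rfl⟩
      exact ⟨p, hp, hf p hp⟩
  rw [h, Set.InjOn.ncard_image, Set.ncard_coe_finset]
  intro p hp q hq hpq
  exact hinj p hp q hq (f p) (hf p hp) (hpq ▸ hf q hq)

/-- `π` starts with `k`, has its maximum at position `p`, and all other entries increase. -/
structure IsTopInserted {n : ℕ} (k p : ℕ) (π : Equiv.Perm (Fin n)) : Prop where
  first : ∀ x : Fin n, (x : ℕ) = 0 → (π x : ℕ) = k
  top : ∀ x : Fin n, (x : ℕ) = p → (π x : ℕ) + 1 = n
  mono : ∀ x y : Fin n, (x : ℕ) < y → (x : ℕ) ≠ 0 → (x : ℕ) ≠ p → (y : ℕ) ≠ p →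
    (π x : ℕ) < π y

/-- `π` starts with `k`; the entries larger than `k` occupy in increasing order the consecutive
positions starting at `a`, and the entries smaller than `k` also increase. -/
structure IsBlockInserted {n : ℕ} (k a : ℕ) (π : Equiv.Perm (Fin n)) : Prop where
  first : ∀ x : Fin n, (x : ℕ) = 0 → (π x : ℕ) = k
  high : ∀ x : Fin n, a ≤ (x : ℕ) → (x : ℕ) + k + 2 ≤ a + n → k < π x
  low : ∀ x : Fin n, (x : ℕ) ≠ 0 → ((x : ℕ) < a ∨ a + n < (x : ℕ) + k + 2) → (π x : ℕ) < k
  mono : ∀ x y : Fin n, (x : ℕ) < y → (x : ℕ) ≠ 0 →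
    ((a ≤ (x : ℕ) ∧ (x : ℕ) + k + 2 ≤ a + n) ↔ (a ≤ (y : ℕ) ∧ (y : ℕ) + k + 2 ≤ a + n)) →
    (π x : ℕ) < π y

/-- The admissible parameters of `IsTopInserted`. -/
def topParams (n : ℕ) : Finset (ℕ × ℕ) :=
  insert (n - 1, 0) ((Finset.Icc 1 (n - 1)).map ⟨Prod.mk 0, Prod.mk_right_injective 0⟩ ∪
    Finset.Icc 1 (n - 2) ×ˢ Finset.Icc 2 (n - 1))

/-- The admissible parameters of `IsBlockInserted`. -/
def blockParams (n : ℕ) : Finset (Σ _ : ℕ, ℕ) :=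
  (Finset.range (n - 2)).sigma fun k => Finset.Icc 2 k

theorem mem_topParams {n k p : ℕ} :
    (k, p) ∈ topParams n ↔ (k = n - 1 ∧ p = 0) ∨ (k = 0 ∧ 1 ≤ p ∧ p ≤ n - 1) ∨
      (1 ≤ k ∧ k ≤ n - 2 ∧ 2 ≤ p ∧ p ≤ n - 1) := by
  simp [topParams]
  omega

theorem mem_blockParams {n k a : ℕ} : ⟨k, a⟩ ∈ blockParams n ↔ k < n - 2 ∧ 2 ≤ a ∧ a ≤ k := by
  simp [blockParams]

theorem card_topParams {n : ℕ} (hn : 3 ≤ n) : (topParams n).card = n + (n - 2) * (n - 2) := by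
  rw [topParams, Finset.card_insert_of_notMem, Finset.card_union_of_disjoint]
  · simp
    obtain ⟨m, rfl⟩ := Nat.exists_eq_add_of_le hn
    have : 3 + m - 1 - 1 = 3 + m - 2 := by omega
    rw [this]
    omega
  · rw [Finset.disjoint_left]
    rintro ⟨k, p⟩ h
    simp at h ⊢
    omega
  · simp

theorem card_blockParams {m : ℕ} : ((blockParams (m + 3)).card : ℚ) = m * (m - 1) / 2 := by
  rw [blockParams, Finset.card_sigma]
  simp only [Nat.card_Icc]
  have : m + 3 - 2 = m + 1 := by omega
  rw [this]
  induction m with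
  | zero => simp
  | succ m ih =>
    rw [Finset.sum_range_succ, Nat.cast_add, ih (by omega)]
    have : m + 1 + 1 - 2 = m := by omega
    rw [this]
    push_cast
    ring

section TopInserted

variable {n k p : ℕ}

theorem IsTopInserted.eq {π σ : Equiv.Perm (Fin n)} (hπ : IsTopInserted k p π)
    (hσ : IsTopInserted k p σ) : π = σ := by
  refine perm_eq_of_strictMono_on_colors
    (fun x : Fin n => if (x : ℕ) = 0 then 0 else if (x : ℕ) = p then 1 else 2) ?_ ?_ ?_
  · intro x y hxy
    have hn : 0 < n := x.pos
    have key : ∀ z : Fin n, π z = σ z → (x = z ↔ y = z) := by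
      intro z hz
      rw [← π.apply_eq_iff_eq, hxy, hz, σ.apply_eq_iff_eq]
    have h0 : (x : ℕ) = 0 ↔ (y : ℕ) = 0 := by
      have := key ⟨0, hn⟩ (Fin.ext (by rw [hπ.first _ rfl, hσ.first _ rfl]))
      simpa [Fin.ext_iff] using this
    have hp : (x : ℕ) = p ↔ (y : ℕ) = p := by
      by_cases hpn : p < n
      · have := key ⟨p, hpn⟩
          (Fin.ext (by have := hπ.top ⟨p, hpn⟩ rfl; have := hσ.top ⟨p, hpn⟩ rfl; omega))
        simpa [Fin.ext_iff] using this
      · omega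
    simp only [h0, hp]
  · intro x y hxy hc
    rw [Fin.lt_def] at *
    refine hπ.mono x y hxy ?_ ?_ ?_ <;> split_ifs at hc <;> omega
  · intro x y hxy hc
    rw [Fin.lt_def] at *
    refine hσ.mono x y hxy ?_ ?_ ?_ <;> split_ifs at hc <;> omega

theorem exists_isTopInserted (h : (k, p) ∈ topParams n) (hn : 3 ≤ n) :
    ∃ π : Equiv.Perm (Fin n), IsTopInserted k p π := by
  rw [mem_topParams] at h
  obtain ⟨π, hπ⟩ := exists_perm_of_injOn (n := n)
    (fun x => if x = 0 then k else if x = p then n - 1 else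
      if x < p ∨ p = 0 then (if x - 1 < k then x - 1 else x)
      else (if x - 2 < k then x - 2 else x - 1))
    (by intro x hx; split_ifs <;> omega)
    (by intro x hx y hy hxy; split_ifs <;> omega)
  refine ⟨π, ?_, ?_, ?_⟩
  · intro x hx
    simp [hπ, hx]
  · intro x hx
    rw [hπ]
    split_ifs <;> omega
  · intro x y hxy hx hxp hyp
    rw [hπ, hπ]
    split_ifs <;> omega

theorem IsTopInserted.params_eq {k' p' : ℕ} {π : Equiv.Perm (Fin n)} (hn : 3 ≤ n)
    (h : IsTopInserted k p π) (h' : IsTopInserted k' p' π) (hp : (k, p) ∈ topParams n)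
    (hp' : (k', p') ∈ topParams n) : (k, p) = (k', p') := by
  rw [mem_topParams] at hp hp'
  have h0 := h.first ⟨0, by omega⟩ rfl
  have h0' := h'.first ⟨0, by omega⟩ rfl
  have h1 := h.top ⟨p, by omega⟩ rfl
  have h1' := h'.top ⟨p', by omega⟩ rfl
  have := (apply_val_eq_iff π ⟨p, by omega⟩ ⟨p', by omega⟩).1 (by omega)
  simp only at this
  ext <;> simp only <;> omega

theorem IsTopInserted.mem {π : Equiv.Perm (Fin n)} (hn : 3 ≤ n)
    (h : IsTopInserted k p π) (hp : (k, p) ∈ topParams n) :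
    IsFishburn π ∧ Avoids π ![3, 2, 1] ∧ Avoids π ![1, 3, 2, 4] := by
  rw [isFishburn_iff, avoids_321_iff, avoids_1324_iff]
  rw [mem_topParams] at hp
  refine ⟨?_, ?_, ?_⟩
  · intro x y z hxy hyz h1 h2
    have := h.top x
    have := h.top z
    by_cases hx : (x : ℕ) = 0
    · have := h.first x hx
      obtain ⟨w, hw⟩ := exists_val_eq π (v := 0) (by omega)
      have := h.first w
      have := h.top w
      have := h.mono y w
      have := apply_val_eq_iff π y w
      omega
    · have := h.mono x z
      omega
  · intro x y z hxy hyz h1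
    have := (π x).2
    have := h.top y
    have := h.top z
    have := h.mono y z
    omega
  · intro w x y z hwx hxy hyz h1 h2
    have := h.top y
    have := h.top x
    have := h.mono x y
    omega

end TopInserted

section BlockInserted

variable {n k a : ℕ}

theorem IsBlockInserted.eq {π σ : Equiv.Perm (Fin n)} (hπ : IsBlockInserted k a π)
    (hσ : IsBlockInserted k a σ) : π = σ := by
  refine perm_eq_of_strictMono_on_colors
    (fun x : Fin n => if (x : ℕ) = 0 then 0 else
      if a ≤ (x : ℕ) ∧ (x : ℕ) + k + 2 ≤ a + n then 1 else 2) ?_ ?_ ?_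
  · intro x y hxy
    have hxy' : (π x : ℕ) = σ y := by rw [hxy]
    have := hπ.first x
    have := hπ.high x
    have := hπ.low x
    have := hσ.first y
    have := hσ.high y
    have := hσ.low y
    split_ifs <;> omega
  · intro x y hxy hc
    rw [Fin.lt_def] at *
    refine hπ.mono x y hxy ?_ ?_ <;> split_ifs at hc <;> omega
  · intro x y hxy hc
    rw [Fin.lt_def] at *
    refine hσ.mono x y hxy ?_ ?_ <;> split_ifs at hc <;> omega

theorem exists_isBlockInserted (h : ⟨k, a⟩ ∈ blockParams n) :
    ∃ π : Equiv.Perm (Fin n), IsBlockInserted k a π := by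
  rw [mem_blockParams] at h
  obtain ⟨π, hπ⟩ := exists_perm_of_injOn (n := n)
    (fun x => if x = 0 then k else if x < a then x - 1 else
      if x + k + 2 ≤ a + n then x + k + 1 - a else x + k - n)
    (by intro x hx; split_ifs <;> omega)
    (by intro x hx y hy hxy; split_ifs <;> omega)
  refine ⟨π, ?_, ?_, ?_, ?_⟩
  · intro x hx
    simp [hπ, hx]
  · intro x hx hx'
    rw [hπ]
    split_ifs <;> omega
  · intro x hx hx'
    rw [hπ]
    split_ifs <;> omega
  · intro x y hxy hx hxp
    rw [hπ, hπ]
    split_ifs <;> omega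

theorem IsBlockInserted.params_eq {k' a' : ℕ} {π : Equiv.Perm (Fin n)}
    (h : IsBlockInserted k a π) (h' : IsBlockInserted k' a' π) (hp : ⟨k, a⟩ ∈ blockParams n)
    (hp' : ⟨k', a'⟩ ∈ blockParams n) : (⟨k, a⟩ : Σ _ : ℕ, ℕ) = ⟨k', a'⟩ := by
  rw [mem_blockParams] at hp hp'
  have h0 := h.first ⟨0, by omega⟩ rfl
  have h0' := h'.first ⟨0, by omega⟩ rfl
  obtain rfl : k = k' := by omega
  have h1 := h.high ⟨a, by omega⟩
  have h1' := h'.high ⟨a', by omega⟩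
  have h2 := h.low ⟨a', by omega⟩
  have h2' := h'.low ⟨a, by omega⟩
  simp only at h1 h1' h2 h2'
  obtain rfl : a = a' := by omega
  rfl

theorem IsBlockInserted.mem {π : Equiv.Perm (Fin n)}
    (h : IsBlockInserted k a π) (hp : ⟨k, a⟩ ∈ blockParams n) :
    IsFishburn π ∧ Avoids π ![3, 2, 1] ∧ Avoids π ![1, 3, 2, 4] := by
  rw [isFishburn_iff, avoids_321_iff, avoids_1324_iff]
  rw [mem_blockParams] at hp
  refine ⟨?_, ?_, ?_⟩
  · intro x y z hxy hyz h1 h2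
    by_cases hx : (x : ℕ) = 0
    · have := h.first x hx
      have := h.low y
      omega
    · have := h.mono x z
      have := h.high x
      have := h.low x
      have := h.high z
      have := h.low z
      omega
  · intro x y z hxy hyz h1
    have := h.first x
    have := h.mono y z
    have := h.mono x y
    have := h.high x
    have := h.low x
    have := h.high y
    have := h.low y
    have := h.high z
    have := h.low z
    omega
  · intro w x y z hwx hxy hyz h1 h2
    have := h.mono x y
    have := h.high x
    have := h.low x
    have := h.high y
    have := h.low y
    have := h.low z
    omega

theorem IsBlockInserted.not_isTopInserted {k' p : ℕ} {π : Equiv.Perm (Fin n)}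
    (h : IsBlockInserted k a π) (hp : ⟨k, a⟩ ∈ blockParams n) (h' : IsTopInserted k' p π) :
    False := by
  rw [mem_blockParams] at hp
  have h1 := h.high ⟨a, by omega⟩
  have h2 := h.low ⟨n - 1, by omega⟩
  have h3 := h.mono ⟨a, by omega⟩ ⟨a + 1, by omega⟩
  have h4 := h'.mono ⟨a, by omega⟩ ⟨n - 1, by omega⟩
  have h5 := h'.top ⟨a, by omega⟩
  have h6 := h'.top ⟨n - 1, by omega⟩
  simp only at h1 h2 h3 h4 h5 h6
  omega

end BlockInserted

/-- In a permutation that is Fishburn and avoids `321`, the entry `0` is among the first two. -/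
theorem exists_apply_eq_zero {n : ℕ} {π : Equiv.Perm (Fin n)} (hn : 3 ≤ n) (hF : IsFishburn π)
    (h321 : Avoids π ![3, 2, 1]) : ∃ e : Fin n, (π e : ℕ) = 0 ∧ (e : ℕ) ≤ 1 := by
  rw [isFishburn_iff] at hF
  rw [avoids_321_iff] at h321
  obtain ⟨e, he⟩ := exists_val_eq π (v := 0) (by omega)
  refine ⟨e, he, ?_⟩
  by_contra hlt
  obtain ⟨x, hx⟩ : ∃ x : Fin n, (x : ℕ) = 0 := ⟨⟨0, by omega⟩, rfl⟩
  obtain ⟨y, hy⟩ : ∃ y : Fin n, (y : ℕ) = 1 := ⟨⟨1, by omega⟩, rfl⟩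
  obtain ⟨z, hz⟩ := exists_val_eq π (v := π x - 1) (by omega)
  have := apply_val_eq_iff π x e
  have := apply_val_eq_iff π y e
  have := apply_val_eq_iff π x y
  have := apply_val_eq_iff π z x
  have := apply_val_eq_iff π z y
  have := hF x y z
  have := h321 x y e
  omega

theorem exists_params {n : ℕ} {π : Equiv.Perm (Fin n)} (hn : 3 ≤ n) (hF : IsFishburn π)
    (h321 : Avoids π ![3, 2, 1]) (h1324 : Avoids π ![1, 3, 2, 4]) :
    (∃ q ∈ topParams n, IsTopInserted q.1 q.2 π) ∨
      ∃ q ∈ blockParams n, IsBlockInserted q.1 q.2 π := by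
  obtain ⟨e, he, he1⟩ := exists_apply_eq_zero hn hF h321
  rw [isFishburn_iff] at hF
  rw [avoids_321_iff] at h321
  rw [avoids_1324_iff] at h1324
  obtain ⟨p, hp⟩ := exists_val_eq π (v := n - 1) (by omega)
  obtain ⟨o, ho⟩ : ∃ o : Fin n, (o : ℕ) = 0 := ⟨⟨0, by omega⟩, rfl⟩
  have inj := apply_val_eq_iff π
  have hlt : ∀ x : Fin n, (π x : ℕ) < n := fun x => (π x).2
  have hpo := inj p o
  have heo := inj e o
  have hpe := inj p e
  by_cases hmono : ∀ x y : Fin n, (x : ℕ) < y → (x : ℕ) ≠ 0 → (x : ℕ) ≠ p → (y : ℕ) ≠ p →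
      (π x : ℕ) < π y
  · refine Or.inl ⟨((π o : ℕ), (p : ℕ)), ?_, ?_, ?_, hmono⟩
    · rw [mem_topParams]
      have := hlt o
      omega
    · intro x hx
      exact (inj x o).2 (by omega)
    · intro x hx
      have := (inj x p).2 hx
      simp only at *
      omega
  · right
    push Not at hmono
    obtain ⟨x, y, hxy, hx0, hxp, hyp, hyx⟩ := hmono
    have hex : (e : ℕ) < x := by
      have := inj x y; have := inj x e; omega
    have hyx' : (π y : ℕ) < π x := by
      have := inj x y; omega
    have hltp : ∀ x : Fin n, (x : ℕ) ≠ p → (π x : ℕ) < π p := fun x hx => by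
      have := inj x p; have := hlt x; omega
    have hpos : ∀ x : Fin n, (x : ℕ) ≠ e → (π e : ℕ) < π x := fun x hx => by
      have := inj x e; omega
    have hxp' : (x : ℕ) < p := by
      have := h321 p x y
      have := hltp x
      omega
    have hpy : (p : ℕ) < y := by
      have := h1324 e x y p
      have := hpos y
      have := hltp x
      omega
    obtain ⟨a, ⟨hea, hap, b, hpb, hba⟩, hmin⟩ :=
      WellFounded.has_min (wellFounded_lt (α := Fin n))
        {a | (e : ℕ) < a ∧ (a : ℕ) < p ∧ ∃ b : Fin n, (p : ℕ) < b ∧ (π b : ℕ) < π a}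
        ⟨x, hex, hxp', y, hpy, hyx'⟩
    have hbefore : ∀ x y : Fin n, (e : ℕ) < x → (x : ℕ) < a → (p : ℕ) < y →
        (π x : ℕ) < π y := by
      intro x y h1 h2 h3
      by_contra h4
      have := inj x y
      exact hmin x ⟨h1, by omega, y, h3, by omega⟩ h2
    have hright : ∀ z : Fin n, (p : ℕ) < z → (π z : ℕ) < π a := by
      intro z hz
      have := h1324 e a b z
      have := h321 p z b
      have := hpos b
      have := hltp z
      have := inj z a
      have := inj z b
      omega
    have hincl : ∀ x y : Fin n, (e : ℕ) < x → (x : ℕ) < y → (y : ℕ) ≤ p →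
        (π x : ℕ) < π y := by
      intro x y h1 h2 h3
      have := h1324 e x y p
      have := hpos y
      have := hltp x
      have := inj x y
      have := inj y p
      omega
    have hincr : ∀ x y : Fin n, (p : ℕ) < x → (x : ℕ) < y → (π x : ℕ) < π y := by
      intro x y h1 h2
      have := h321 p x y
      have := hltp x
      have := inj x y
      omega
    have hak : (π a : ℕ) = π o + 1 := by
      obtain ⟨q, hq⟩ := exists_val_eq π (v := π a - 1) (by have := hlt a; omega)
      obtain ⟨a', ha'⟩ : ∃ a' : Fin n, (a' : ℕ) = a + 1 := ⟨⟨a + 1, by omega⟩, rfl⟩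
      have := hF a a' q
      have := hincl a a'
      have := hincl a q
      have := hbefore q b
      have := inj q o
      have := inj q e
      have := inj q a
      have := inj q a'
      have := hpos b
      omega
    have hao : ∀ x : Fin n, (x : ℕ) ≠ 0 → (π x : ℕ) ≠ π o := fun x hx => by
      have := inj x o; omega
    have hcard : (p : ℕ) + 1 - a = n - 1 - π o := by
      have : (Finset.Icc a p).map π.toEmbedding = Finset.Ioi (π o) := by
        ext v
        obtain ⟨z, rfl⟩ := π.surjective v
        simp only [Finset.mem_map_equiv, Equiv.symm_apply_apply, Finset.mem_Icc, Finset.mem_Ioi,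
          Fin.le_def, Fin.lt_def]
        have := hincl a z
        have := hincl z a
        have := hright z
        have := inj z o
        have := inj z a
        have := inj z e
        have := hao z
        omega
      have := congrArg Finset.card this
      rwa [Finset.card_map, Fin.card_Icc, Fin.card_Ioi] at this
    have hpb' : (p : ℕ) + 1 < n := by omega
    have heq : (e : ℕ) = 1 := by
      have := hpos b; omega
    have hlto := hlt o
    refine ⟨⟨π o, a⟩, ?_, ?_, ?_, ?_, ?_⟩
    · rw [mem_blockParams]
      omega
    · intro x hx
      exact (inj x o).2 (by omega)
    · intro x h1 h2
      simp only at *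
      have := hincl a x
      have := inj a x
      omega
    · intro x h1 h2
      simp only at *
      have := hincl x a
      have := hright x
      have := hao x
      have := inj x e
      omega
    · intro x y h1 h2 h3
      simp only at *
      have := hincl x y
      have := hincr x y
      have := hbefore x y
      have := inj x e
      have := hpos y
      omega

theorem fishburn_321_1324 (n : ℕ) (hn : 3 ≤ n) :
    ({π : Equiv.Perm (Fin n) | IsFishburn π ∧ Avoids π ![3, 2, 1] ∧ Avoids π ![1, 3, 2, 4]}.ncard : ℚ) = 3 / 2 * n ^ 2 - 13 / 2 * n + 10 := by
  have hset : {π : Equiv.Perm (Fin n) | IsFishburn π ∧ Avoids π ![3, 2, 1] ∧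
      Avoids π ![1, 3, 2, 4]} = {π | ∃ q ∈ topParams n, IsTopInserted q.1 q.2 π} ∪
        {π | ∃ q ∈ blockParams n, IsBlockInserted q.1 q.2 π} := by
    ext π
    constructor
    · rintro ⟨h1, h2, h3⟩
      exact exists_params hn h1 h2 h3
    · rintro (⟨q, hq, h⟩ | ⟨q, hq, h⟩)
      · exact h.mem hn hq
      · exact h.mem hq
  have hdisj : Disjoint {π : Equiv.Perm (Fin n) | ∃ q ∈ topParams n, IsTopInserted q.1 q.2 π}
      {π | ∃ q ∈ blockParams n, IsBlockInserted q.1 q.2 π} := by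
    rw [Set.disjoint_left]
    rintro π ⟨q, -, h⟩ ⟨r, hr, h'⟩
    exact h'.not_isTopInserted hr h
  rw [hset, Set.ncard_union_eq hdisj,
    ncard_setOf_exists_rel (topParams n) (fun q π => IsTopInserted q.1 q.2 π)
      (fun q hq => exists_isTopInserted hq hn) (fun q _ _ _ h h' => h.eq h')
      (fun q hq r hr π h h' => h.params_eq hn h' hq hr),
    ncard_setOf_exists_rel (blockParams n) (fun q π => IsBlockInserted q.1 q.2 π)
      (fun q hq => exists_isBlockInserted hq) (fun q _ _ _ h h' => h.eq h')
      (fun q hq r hr π h h' => h.params_eq h' hq hr),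
    card_topParams hn]
  obtain ⟨m, rfl⟩ := Nat.exists_eq_add_of_le' hn
  have : m + 3 - 2 = m + 1 := by omega
  rw [Nat.cast_add, card_blockParams, this]
  push_cast
  ring
end

section
/- For n ≥ 1, the number of Fishburn permutations of length n avoiding the classical patterns 321 and 31452 equals (P_n + P_{n-1} + 1)/2, where P_n are the Pell numbers with P_0 = 0, P_1 = 1, and P_n = 2P_{n-1} + P_{n-2}. -/
/-- Pell numbers: `P 0 = 0`, `P 1 = 1`, `P (n+2) = 2 * P (n+1) + P n`. -/
def pell : ℕ → ℕ
  | 0 => 0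
  | 1 => 1
  | n + 2 => 2 * pell (n + 1) + pell n

/-- The permutation obtained from `σ` by raising all its values by one and inserting the
value `0` at position `p`. -/
def insertZero {n : ℕ} (p : Fin (n + 1)) (σ : Equiv.Perm (Fin n)) : Equiv.Perm (Fin (n + 1)) :=
  (finSuccEquiv' p).trans ((Equiv.optionCongr σ).trans (finSuccEquiv' 0).symm)

@[simp] lemma insertZero_self {n : ℕ} (p : Fin (n + 1)) (σ : Equiv.Perm (Fin n)) :
    insertZero p σ p = 0 := by
  simp [insertZero]

@[simp] lemma insertZero_succAbove {n : ℕ} (p : Fin (n + 1)) (σ : Equiv.Perm (Fin n))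
    (i : Fin n) : insertZero p σ (p.succAbove i) = (σ i).succ := by
  simp [insertZero]

lemma insertZero_injective {n : ℕ} (p : Fin (n + 1)) :
    Function.Injective (insertZero p) := by
  intro σ τ h
  ext i : 1
  have := congrArg (fun π : Equiv.Perm (Fin (n + 1)) => π (p.succAbove i)) h
  simpa using this

lemma exists_insertZero_eq {n : ℕ} {p : Fin (n + 1)} {π : Equiv.Perm (Fin (n + 1))}
    (h : π p = 0) : ∃ σ, insertZero p σ = π := by
  have hne (i : Fin n) : π (p.succAbove i) ≠ 0 := fun hi =>
    Fin.succAbove_ne p i (π.injective (hi.trans h.symm))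
  have hinj : Function.Injective fun i : Fin n => (π (p.succAbove i)).pred (hne i) := by
    intro i j hij
    exact Fin.succAbove_right_injective (π.injective (Fin.pred_inj.mp hij))
  refine ⟨Equiv.ofBijective _ (Finite.injective_iff_bijective.mp hinj), ?_⟩
  ext i : 1
  induction i using Fin.succAboveCases p with
  | x => simp [h]
  | p i => simp

lemma val_succAbove {n : ℕ} (p : Fin (n + 1)) (i : Fin n) :
    (p.succAbove i : ℕ) = if (i : ℕ) < p then (i : ℕ) else i + 1 := by
  simp only [Fin.succAbove, Fin.lt_def, Fin.val_castSucc]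
  split_ifs <;> simp

/-- Permutations avoiding 321 and 31452 which satisfy the Fishburn condition except possibly at
the first `e` positions, and in which no occurrence of 2341 begins at one of these positions. -/
structure InClass {n : ℕ} (e : ℕ) (π : Equiv.Perm (Fin n)) : Prop where
  no321 : ∀ i j k, i < j → j < k → π k < π j → π j < π i → False
  no31452 : ∀ i j k l m, i < j → j < k → k < l → l < m →
    π j < π m → π m < π i → π i < π k → π k < π l → False
  fishburn : ∀ i i' j, e ≤ i.val → i'.val = i.val + 1 → i < j → π i < π i' →
    (π i : ℕ) = (π j : ℕ) + 1 → False
  no2341 : ∀ i j k l, i.val < e → i < j → j < k → k < l →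
    π l < π i → π i < π j → π j < π k → False

lemma inClass_zero_iff {n : ℕ} (π : Equiv.Perm (Fin n)) :
    InClass 0 π ↔ IsFishburn π ∧ Avoids π ![3, 2, 1] ∧ Avoids π ![3, 1, 4, 5, 2] := by
  constructor
  · intro h
    refine ⟨?_, ?_, ?_⟩
    · rintro ⟨i, j, hij, hj, h1, -, h3⟩
      exact h.fishburn ⟨i, by omega⟩ ⟨i + 1, by omega⟩ ⟨j, hj⟩ (Nat.zero_le _) rfl
        (Fin.mk_lt_mk.mpr (by omega)) h1 h3
    · rintro ⟨f, hf, hp⟩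
      exact h.no321 (f 0) (f 1) (f 2) (hf (by decide)) (hf (by decide))
        ((hp 2 1).mp (by decide)) ((hp 1 0).mp (by decide))
    · rintro ⟨f, hf, hp⟩
      exact h.no31452 (f 0) (f 1) (f 2) (f 3) (f 4) (hf (by decide)) (hf (by decide))
        (hf (by decide)) (hf (by decide)) ((hp 1 4).mp (by decide)) ((hp 4 0).mp (by decide))
        ((hp 0 2).mp (by decide)) ((hp 2 3).mp (by decide))
  · rintro ⟨hF, h321, h31452⟩
    refine ⟨?_, ?_, ?_, ?_⟩
    · intro i j k hij hjk h1 h2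
      refine h321 ⟨![i, j, k], ?_, ?_⟩
      · rw [Fin.strictMono_iff_lt_succ]
        simp [Fin.forall_fin_succ, hij, hjk]
      · simp only [Fin.lt_def] at *
        simp [Fin.forall_fin_succ]
        omega
    · intro i j k l m hij hjk hkl hlm h1 h2 h3 h4
      refine h31452 ⟨![i, j, k, l, m], ?_, ?_⟩
      · rw [Fin.strictMono_iff_lt_succ]
        simp [Fin.forall_fin_succ, hij, hjk, hkl, hlm]
      · simp only [Fin.lt_def] at *
        simp [Fin.forall_fin_succ]
        omega
    · rintro ⟨i, hi⟩ ⟨i', hi'⟩ ⟨j, hj⟩ - hii hij h1 h2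
      obtain rfl : i' = i + 1 := hii
      have hne : j ≠ i + 1 := by
        rintro rfl
        rw [Fin.lt_def] at h1
        omega
      rw [Fin.mk_lt_mk] at hij
      exact hF ⟨i, j, by omega, hj, h1, Fin.lt_def.mpr (by omega), h2⟩
    · intro i j k l hi
      omega

lemma inClass_of_le_two {n : ℕ} (hn : n ≤ 2) (e : ℕ) (π : Equiv.Perm (Fin n)) : InClass e π := by
  refine ⟨?_, ?_, ?_, ?_⟩
  · intro i j k
    omega
  · intro i j k
    omega
  · intro i i' j _ hi hij h1 h2
    obtain rfl : i' = j := by omega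
    omega
  · intro i j k l
    omega

lemma inClass_insertZero_zero_iff {n : ℕ} (e : ℕ) (σ : Equiv.Perm (Fin n)) :
    InClass e (insertZero 0 σ) ↔ InClass (e - 1) σ := by
  have h0 : insertZero 0 σ 0 = 0 := insertZero_self 0 σ
  have hs (i : Fin n) : insertZero 0 σ i.succ = (σ i).succ := insertZero_succAbove 0 σ i
  constructor
  · rintro ⟨h1, h2, h3, h4⟩
    refine ⟨?_, ?_, ?_, ?_⟩
    · intro i j k
      simpa [hs] using h1 i.succ j.succ k.succ
    · intro i j k l m
      simpa [hs] using h2 i.succ j.succ k.succ l.succ m.succ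
    · intro i i' j a b
      simpa [hs] using h3 i.succ i'.succ j.succ (by simp; omega) (by simp; omega)
    · intro i j k l a
      simpa [hs] using h4 i.succ j.succ k.succ l.succ (by simp; omega)
  · rintro ⟨h1, h2, h3, h4⟩
    refine ⟨?_, ?_, ?_, ?_⟩
    · simpa [Fin.forall_fin_succ, h0, hs] using h1
    · simpa [Fin.forall_fin_succ, h0, hs] using h2
    · simp [Fin.forall_fin_succ, h0, hs]
      intro i i' j a b
      exact h3 i i' j (by omega) b
    · simp only [Fin.forall_fin_succ, h0, hs, Fin.val_succ, Fin.not_lt_zero, Fin.succ_lt_succ_iff,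
        IsEmpty.forall_iff, implies_true, true_and]
      intro i j k l a
      exact h4 i j k l (by omega)

lemma exists_succAbove_of_insertZero_ne {n : ℕ} {p : Fin (n + 1)} {σ : Equiv.Perm (Fin n)}
    {i : Fin (n + 1)} (h : insertZero p σ i ≠ 0) : ∃ a, p.succAbove a = i :=
  Fin.exists_succAbove_eq (by rintro rfl; simp at h)

lemma InClass.of_insertZero {n e : ℕ} {p : Fin (n + 1)} {σ : Equiv.Perm (Fin n)}
    (hp : (p : ℕ) ≤ e + 1) (hep : e ≤ p)
    (h : InClass e (insertZero p σ)) : InClass p σ := by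
  obtain ⟨h1, h2, h3, h4⟩ := h
  refine ⟨?_, ?_, ?_, ?_⟩
  · intro i j k
    simpa using h1 (p.succAbove i) (p.succAbove j) (p.succAbove k)
  · intro i j k l m
    simpa using h2 (p.succAbove i) (p.succAbove j) (p.succAbove k) (p.succAbove l)
      (p.succAbove m)
  · intro i i' j hi hi' hij
    simpa [hij] using h3 (p.succAbove i) (p.succAbove i') (p.succAbove j)
      (by rw [val_succAbove]; split_ifs <;> omega)
      (by rw [val_succAbove, val_succAbove]; split_ifs <;> omega)
  · intro i j k l hi hij hjk hkl hli h5 h6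
    by_cases hie : i.val < e
    · exact h4 (p.succAbove i) (p.succAbove j) (p.succAbove k) (p.succAbove l)
        (by rw [val_succAbove]; split_ifs; omega) (by simpa) (by simpa) (by simpa) (by simpa)
        (by simpa) (by simpa)
    · refine h2 (p.succAbove i) p (p.succAbove j) (p.succAbove k) (p.succAbove l)
        ?_ ?_ (by simpa) (by simpa) (by simp) (by simpa) (by simpa) (by simpa)
      · rw [Fin.lt_def, val_succAbove]; split_ifs; omega
      · rw [Fin.lt_def, val_succAbove]; split_ifs <;> omega

lemma InClass.insertZero {n e : ℕ} {p : Fin (n + 1)} {σ : Equiv.Perm (Fin n)}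
    (hp : (p : ℕ) ≤ e + 1) (hp2 : (p : ℕ) ≤ 2) (hep : e ≤ p)
    (hσ : ∀ i j : Fin n, i < j → (j : ℕ) < p → σ i < σ j)
    (h : InClass p σ) : InClass e (insertZero p σ) := by
  obtain ⟨h1, h2, h3, h4⟩ := h
  have hpos {i j : Fin (n + 1)} (hij : _root_.insertZero p σ i < _root_.insertZero p σ j) :
      ∃ a, p.succAbove a = j :=
    exists_succAbove_of_insertZero_ne (Fin.ne_zero_of_lt hij)
  refine ⟨?_, ?_, ?_, ?_⟩
  · intro i j k hij hjk hkj hji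
    obtain ⟨a, rfl⟩ := hpos hji
    obtain ⟨b, rfl⟩ := hpos hkj
    simp only [Fin.succAbove_lt_succAbove_iff, insertZero_succAbove, Fin.succ_lt_succ_iff] at *
    rcases eq_or_ne k p with rfl | hk
    · refine (hσ a b hij ?_).not_gt hji
      rw [Fin.lt_def, val_succAbove] at hjk
      split_ifs at hjk <;> omega
    · obtain ⟨c, rfl⟩ := Fin.exists_succAbove_eq hk
      simp only [Fin.succAbove_lt_succAbove_iff, insertZero_succAbove, Fin.succ_lt_succ_iff] at *
      exact h1 a b c hij hjk hkj hji
  · intro i j k l m hij hjk hkl hlm hjm hmi hik hkl'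
    obtain ⟨a, rfl⟩ := hpos hmi
    obtain ⟨c, rfl⟩ := hpos hik
    obtain ⟨d, rfl⟩ := hpos hkl'
    obtain ⟨b, rfl⟩ := hpos hjm
    have hac := hij.trans hjk
    simp only [Fin.succAbove_lt_succAbove_iff, insertZero_succAbove, Fin.succ_lt_succ_iff] at *
    rcases eq_or_ne j p with rfl | hj
    · refine h4 a c d b ?_ hac hkl hlm hmi hik hkl'
      rw [Fin.lt_def, val_succAbove] at hij
      split_ifs at hij <;> omega
    · obtain ⟨f, rfl⟩ := Fin.exists_succAbove_eq hj
      simp only [Fin.succAbove_lt_succAbove_iff, insertZero_succAbove, Fin.succ_lt_succ_iff] at *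
      exact h2 a f c d b hij hjk hkl hlm hjm hmi hik hkl'
  · intro i i' j hi hi' hij hii hv
    obtain ⟨a, rfl⟩ := exists_succAbove_of_insertZero_ne (p := p) (σ := σ) (i := i)
      (by rw [ne_eq, Fin.ext_iff, hv]; simp)
    obtain ⟨a', rfl⟩ := hpos hii
    have hap : (p : ℕ) ≤ a := by
      have := val_succAbove p a
      have := val_succAbove p a'
      split_ifs at * <;> omega
    rcases eq_or_ne j p with rfl | hj
    · rw [Fin.lt_def, val_succAbove] at hij
      split_ifs at hij <;> omega
    · obtain ⟨b, rfl⟩ := Fin.exists_succAbove_eq hj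
      rw [val_succAbove, val_succAbove] at hi'
      simp only [Fin.succAbove_lt_succAbove_iff, insertZero_succAbove, Fin.succ_lt_succ_iff,
        Fin.val_succ] at *
      exact h3 a a' b hap (by split_ifs at hi' <;> omega) hij hii (by omega)
  · intro i j k l hi hij hjk hkl hli hij' hjk'
    obtain ⟨a, rfl⟩ := hpos hli
    obtain ⟨b, rfl⟩ := hpos hij'
    obtain ⟨c, rfl⟩ := hpos hjk'
    rcases eq_or_ne l p with rfl | hl
    · omega
    · obtain ⟨d, rfl⟩ := Fin.exists_succAbove_eq hl
      rw [val_succAbove] at hi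
      simp only [Fin.succAbove_lt_succAbove_iff, insertZero_succAbove, Fin.succ_lt_succ_iff] at *
      exact h4 a b c d (by split_ifs at hi <;> omega) hij hjk hkl hli hij' hjk'

lemma InClass.lt_of_lt_zero {n e : ℕ} {π : Equiv.Perm (Fin (n + 1))} (h : InClass e π)
    {i j q : Fin (n + 1)} (hq : π q = 0) (hij : i < j) (hjq : j < q) : π i < π j := by
  by_contra hlt
  have hji : π j < π i := lt_of_le_of_ne (not_lt.mp hlt) (π.injective.ne hij.ne')
  refine h.no321 i j q hij hjq ?_ hji
  rw [hq, Fin.pos_iff_ne_zero, ← hq]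
  exact π.injective.ne hjq.ne

lemma InClass.zero_position_le_two {n e : ℕ} {π : Equiv.Perm (Fin (n + 1))} (h : InClass e π)
    (he : 0 < e) {q : Fin (n + 1)} (hq : π q = 0) : (q : ℕ) ≤ 2 := by
  by_contra! hlt
  refine h.no2341 ⟨0, by omega⟩ ⟨1, by omega⟩ ⟨2, by omega⟩ q he
    (Fin.mk_lt_mk.mpr (by omega)) (Fin.mk_lt_mk.mpr (by omega)) hlt ?_
    (h.lt_of_lt_zero hq (Fin.mk_lt_mk.mpr (by omega)) (Fin.lt_def.mpr (by simp; omega)))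
    (h.lt_of_lt_zero hq (Fin.mk_lt_mk.mpr (by omega)) hlt)
  rw [hq, Fin.pos_iff_ne_zero, ← hq]
  refine π.injective.ne (Fin.ne_of_val_ne ?_)
  simp
  omega

lemma InClass.zero_position_le_one {n : ℕ} {π : Equiv.Perm (Fin (n + 1))} (h : InClass 0 π)
    {q : Fin (n + 1)} (hq : π q = 0) : (q : ℕ) ≤ 1 := by
  by_contra! hlt
  have h01 : π ⟨0, by omega⟩ < π ⟨1, by omega⟩ :=
    h.lt_of_lt_zero hq (Fin.mk_lt_mk.mpr (by omega)) hlt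
  have h0 : π ⟨0, by omega⟩ ≠ 0 := by
    rw [← hq]
    refine π.injective.ne (Fin.ne_of_val_ne ?_)
    simp
    omega
  have hpos : 0 < (π ⟨0, by omega⟩ : ℕ) := Fin.pos_iff_ne_zero.mpr h0
  obtain ⟨j, hj⟩ := π.surjective ⟨(π ⟨0, by omega⟩ : ℕ) - 1, by omega⟩
  have hjv : (π j : ℕ) = (π ⟨0, by omega⟩ : ℕ) - 1 := by rw [hj]
  refine h.fishburn ⟨0, by omega⟩ ⟨1, by omega⟩ j (Nat.zero_le _) rfl ?_ h01 (by omega)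
  refine Fin.pos_iff_ne_zero.mpr ?_
  rintro rfl
  change (π ⟨0, by omega⟩ : ℕ) = _ at hjv
  omega

/-- The permutations in the class with parameter `2` that begin with an ascent. -/
def ascentClass (n : ℕ) : Set (Equiv.Perm (Fin (n + 2))) :=
  {π | InClass 2 π ∧ π 0 < π 1}

lemma setOf_inClass_zero_succ (n : ℕ) :
    {π : Equiv.Perm (Fin (n + 2)) | InClass 0 π} =
      insertZero 0 '' {σ | InClass 0 σ} ∪ insertZero 1 '' {σ | InClass 1 σ} := by
  ext π
  simp only [Set.mem_union, Set.mem_image, Set.mem_ofPred_eq]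
  constructor
  · intro h
    obtain ⟨q, hq⟩ := π.surjective 0
    have hq1 := h.zero_position_le_one hq
    obtain ⟨σ, rfl⟩ := exists_insertZero_eq hq
    obtain rfl | rfl : q = 0 ∨ q = 1 := by
      simp only [Fin.ext_iff, Fin.val_zero, Fin.val_one]
      omega
    · exact .inl ⟨σ, (inClass_insertZero_zero_iff 0 σ).mp h, rfl⟩
    · exact .inr ⟨σ, h.of_insertZero (by simp) (by simp), rfl⟩
  · rintro (⟨σ, hσ, rfl⟩ | ⟨σ, hσ, rfl⟩)
    · exact (inClass_insertZero_zero_iff 0 σ).mpr hσ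
    · exact InClass.insertZero (by simp) (by simp) (by simp)
        (fun i j hij hj => by rw [Fin.val_one] at hj; omega) hσ

lemma insertZero_two_lt_iff {n : ℕ} (σ : Equiv.Perm (Fin (n + 2))) :
    insertZero 2 σ 0 < insertZero 2 σ 1 ↔ σ 0 < σ 1 := by
  have h0 : insertZero 2 σ 0 = (σ 0).succ := insertZero_succAbove 2 σ 0
  have h1 : insertZero 2 σ 1 = (σ 1).succ := insertZero_succAbove 2 σ 1
  rw [h0, h1, Fin.succ_lt_succ_iff]

lemma InClass.insertZero_two {n e : ℕ} {σ : Equiv.Perm (Fin (n + 2))} (he : 1 ≤ e) (he2 : e ≤ 2)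
    (h : σ ∈ ascentClass n) : InClass e (_root_.insertZero 2 σ) := by
  have hval : ((2 : Fin (n + 3)) : ℕ) = 2 := rfl
  refine InClass.insertZero (by omega) (by omega) (by omega) ?_ (by rw [hval]; exact h.1)
  intro i j hij hj
  have hi0 : i = 0 := Fin.ext (by rw [Fin.val_zero]; omega)
  have hj1 : j = 1 := Fin.ext (by rw [Fin.val_one]; omega)
  rw [hi0, hj1]
  exact h.2

lemma setOf_inClass_one_succ (n : ℕ) :
    {π : Equiv.Perm (Fin (n + 3)) | InClass 1 π} =
      insertZero 0 '' {σ | InClass 0 σ} ∪ insertZero 1 '' {σ | InClass 1 σ} ∪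
        insertZero 2 '' ascentClass n := by
  have hval : ((2 : Fin (n + 3)) : ℕ) = 2 := rfl
  ext π
  simp only [Set.mem_union, Set.mem_image, Set.mem_ofPred_eq]
  constructor
  · intro h
    obtain ⟨q, hq⟩ := π.surjective 0
    have hq1 := h.zero_position_le_two one_pos hq
    obtain ⟨σ, rfl⟩ := exists_insertZero_eq hq
    obtain rfl | rfl | rfl : q = 0 ∨ q = 1 ∨ q = 2 := by
      simp only [Fin.ext_iff, Fin.val_zero, Fin.val_one, hval]
      omega
    · exact .inl (.inl ⟨σ, (inClass_insertZero_zero_iff 1 σ).mp h, rfl⟩)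
    · exact .inl (.inr ⟨σ, h.of_insertZero (by simp) (by simp), rfl⟩)
    · refine .inr ⟨σ, ⟨h.of_insertZero (by omega) (by omega), ?_⟩, rfl⟩
      rw [← insertZero_two_lt_iff]
      exact h.lt_of_lt_zero hq (Fin.lt_def.mpr (by simp)) (Fin.lt_def.mpr (by rw [hval]; simp))
  · rintro ((⟨σ, hσ, rfl⟩ | ⟨σ, hσ, rfl⟩) | ⟨σ, hσ, rfl⟩)
    · exact (inClass_insertZero_zero_iff 1 σ).mpr hσ
    · exact InClass.insertZero (by simp) (by simp) (by simp)
        (fun i j hij hj => by rw [Fin.val_one] at hj; omega) hσ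
    · exact InClass.insertZero_two le_rfl (by omega) hσ

lemma ascentClass_succ (n : ℕ) :
    ascentClass (n + 1) =
      insertZero 0 '' {σ | InClass 1 σ} ∪ insertZero 2 '' ascentClass n := by
  have hval : ((2 : Fin (n + 3)) : ℕ) = 2 := rfl
  ext π
  simp only [Set.mem_union, Set.mem_image, Set.mem_ofPred_eq]
  constructor
  · rintro ⟨h, hasc⟩
    obtain ⟨q, hq⟩ := π.surjective 0
    have hq1 := h.zero_position_le_two two_pos hq
    have hq2 : q ≠ 1 := by
      rintro rfl
      rw [hq] at hasc
      exact Fin.not_lt_zero _ hasc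
    obtain ⟨σ, rfl⟩ := exists_insertZero_eq hq
    obtain rfl | rfl : q = 0 ∨ q = 2 := by
      simp only [ne_eq, Fin.ext_iff, Fin.val_zero, Fin.val_one, hval] at hq2 ⊢
      omega
    · exact .inl ⟨σ, (inClass_insertZero_zero_iff 2 σ).mp h, rfl⟩
    · exact .inr ⟨σ, ⟨h.of_insertZero (by omega) (by omega),
        (insertZero_two_lt_iff σ).mp hasc⟩, rfl⟩
  · rintro (⟨σ, hσ, rfl⟩ | ⟨σ, hσ, rfl⟩)
    · refine ⟨(inClass_insertZero_zero_iff 2 σ).mpr hσ, ?_⟩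
      have h1 : insertZero 0 σ 1 = (σ 0).succ := insertZero_succAbove 0 σ 0
      rw [insertZero_self, h1]
      exact Fin.succ_pos _
    · exact ⟨InClass.insertZero_two one_le_two le_rfl hσ, (insertZero_two_lt_iff σ).mpr hσ.2⟩

lemma disjoint_image_insertZero {n : ℕ} {p q : Fin (n + 1)} (hpq : p ≠ q)
    (s t : Set (Equiv.Perm (Fin n))) : Disjoint (insertZero p '' s) (insertZero q '' t) := by
  rw [Set.disjoint_left]
  rintro _ ⟨σ, -, rfl⟩ ⟨τ, -, h⟩
  have hq := insertZero_self q τ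
  rw [h, ← insertZero_self p σ] at hq
  exact hpq ((insertZero p σ).injective hq).symm

lemma ncard_inClass_zero_succ (n : ℕ) :
    {π : Equiv.Perm (Fin (n + 2)) | InClass 0 π}.ncard =
      {σ : Equiv.Perm (Fin (n + 1)) | InClass 0 σ}.ncard +
        {σ : Equiv.Perm (Fin (n + 1)) | InClass 1 σ}.ncard := by
  rw [setOf_inClass_zero_succ, Set.ncard_union_eq (disjoint_image_insertZero (by simp) _ _),
    Set.ncard_image_of_injective _ (insertZero_injective _),
    Set.ncard_image_of_injective _ (insertZero_injective _)]

lemma ncard_inClass_one_succ (n : ℕ) :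
    {π : Equiv.Perm (Fin (n + 3)) | InClass 1 π}.ncard =
      {σ : Equiv.Perm (Fin (n + 2)) | InClass 0 σ}.ncard +
        {σ : Equiv.Perm (Fin (n + 2)) | InClass 1 σ}.ncard + (ascentClass n).ncard := by
  have h02 : (0 : Fin (n + 3)) ≠ 2 := Fin.ne_of_val_ne (by change 0 ≠ 2; decide)
  have h12 : (1 : Fin (n + 3)) ≠ 2 := Fin.ne_of_val_ne (by change 1 ≠ 2; decide)
  rw [setOf_inClass_one_succ, Set.ncard_union_eq (Set.disjoint_union_left.mpr
      ⟨disjoint_image_insertZero h02 _ _, disjoint_image_insertZero h12 _ _⟩),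
    Set.ncard_union_eq (disjoint_image_insertZero (by simp) _ _),
    Set.ncard_image_of_injective _ (insertZero_injective _),
    Set.ncard_image_of_injective _ (insertZero_injective _),
    Set.ncard_image_of_injective _ (insertZero_injective _)]

lemma ncard_ascentClass_succ (n : ℕ) :
    (ascentClass (n + 1)).ncard =
      {σ : Equiv.Perm (Fin (n + 2)) | InClass 1 σ}.ncard + (ascentClass n).ncard := by
  have h02 : (0 : Fin (n + 3)) ≠ 2 := Fin.ne_of_val_ne (by change 0 ≠ 2; decide)
  rw [ascentClass_succ, Set.ncard_union_eq (disjoint_image_insertZero h02 _ _),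
    Set.ncard_image_of_injective _ (insertZero_injective _),
    Set.ncard_image_of_injective _ (insertZero_injective _)]

lemma ncard_inClass_of_le_two {n : ℕ} (hn : n ≤ 2) (e : ℕ) :
    {π : Equiv.Perm (Fin n) | InClass e π}.ncard = n.factorial := by
  rw [Set.eq_univ_of_forall (s := {π : Equiv.Perm (Fin n) | InClass e π})
    (inClass_of_le_two hn e), Set.ncard_univ, Nat.card_perm, Nat.card_fin]

lemma ncard_ascentClass_zero : (ascentClass 0).ncard = 1 := by
  rw [Set.ncard_eq_one]
  refine ⟨1, Set.ext fun π => ?_⟩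
  have hπ : π 0 < π 1 ↔ π = 1 := by
    revert π
    decide
  simp [ascentClass, inClass_of_le_two, hπ]

lemma ncard_inClass_eq_pell (n : ℕ) :
    2 * {π : Equiv.Perm (Fin (n + 2)) | InClass 0 π}.ncard = pell (n + 2) + pell (n + 1) + 1 ∧
      {π : Equiv.Perm (Fin (n + 2)) | InClass 1 π}.ncard = pell (n + 2) ∧
      (ascentClass n).ncard + 1 = {π : Equiv.Perm (Fin (n + 2)) | InClass 0 π}.ncard := by
  induction n with
  | zero =>
    rw [ncard_inClass_of_le_two le_rfl, ncard_inClass_of_le_two le_rfl, ncard_ascentClass_zero]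
    decide
  | succ n ih =>
    obtain ⟨h0, h1, h2⟩ := ih
    have hpell : pell (n + 3) = 2 * pell (n + 2) + pell (n + 1) := rfl
    have h3 : {π : Equiv.Perm (Fin (n + 3)) | InClass 0 π}.ncard =
        {σ : Equiv.Perm (Fin (n + 2)) | InClass 0 σ}.ncard +
          {σ : Equiv.Perm (Fin (n + 2)) | InClass 1 σ}.ncard := ncard_inClass_zero_succ (n + 1)
    have h4 := ncard_inClass_one_succ n
    have h5 := ncard_ascentClass_succ n
    change 2 * {π : Equiv.Perm (Fin (n + 3)) | InClass 0 π}.ncard =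
        pell (n + 3) + pell (n + 2) + 1 ∧
      {π : Equiv.Perm (Fin (n + 3)) | InClass 1 π}.ncard = pell (n + 3) ∧
      (ascentClass (n + 1)).ncard + 1 = {π : Equiv.Perm (Fin (n + 3)) | InClass 0 π}.ncard
    omega

theorem fishburn_321_31452 (n : ℕ) (hn : 1 ≤ n) :
    {π : Equiv.Perm (Fin n) | IsFishburn π ∧ Avoids π ![3, 2, 1] ∧ Avoids π ![3, 1, 4, 5, 2]}.ncard = (pell n + pell (n - 1) + 1) / 2 := by
  simp only [← inClass_zero_iff]
  obtain rfl | ⟨m, rfl⟩ : n = 1 ∨ ∃ m, n = m + 2 := by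
    rcases n with _ | _ | m
    · omega
    · exact .inl rfl
    · exact .inr ⟨m, rfl⟩
  · rw [ncard_inClass_of_le_two one_le_two]
    decide
  · have h := (ncard_inClass_eq_pell m).1
    simp only [Nat.add_succ_sub_one]
    omega
end
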